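/- Let p be a prime element of 𝒪 with p ≡ 1 (mod 3), let w, B ∈ 𝒪 with wB coprime to p, let j ≥ 1 be an integer, and for k ≥ 1 set S(j,k) := ∑_{A (p^k)*} (A/p^k)₃ · e(p·(wA)⁻¹/p^k) · ∑_{x (p^k)} e((A w² x³ + p^j B x)/p^k). Then S(j,1) = φ(p)·(w/p)₃·g(1,p), S(j,2) = N(p)²·(w/p)₃·g(1,p), and S(j,k) = 0 for every k ≥ 3. -/

import Mathlib

noncomputable section

namespace CubicSeries

open scoped Classical

def ω : ℂ := Complex.exp (2 * Real.pi * Complex.I / 3)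

def O : Subring ℂ := Subring.closure {ω}

abbrev OK : Type _ := O

def δ : ℂ := ω - ω ^ 2

def eC (z : ℂ) : ℂ :=
  Complex.exp (2 * Real.pi * Complex.I * (z / δ + (starRingEnd ℂ) (z / δ)))

def rep {I : Ideal OK} (x : OK ⧸ I) : OK :=
  Function.surjInv Ideal.Quotient.mk_surjective x

/-- `N(c) = |𝒪/(c)|`, the absolute norm. -/
def Nm (c : OK) : ℕ := Nat.card (OK ⧸ Ideal.span {c})

/-- `φ(c) = |(𝒪/(c))ˣ|`. -/
def totient (c : OK) : ℕ := Nat.card ((OK ⧸ Ideal.span {c})ˣ)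

/-- a multiplicative inverse modulo `c` (an arbitrary element when `x` is not invertible). -/
def invMod (c x : OK) : OK :=
  rep (Ring.inverse (Ideal.Quotient.mk (Ideal.span {c}) x))

def T (A B c : OK) : ℂ :=
  ∑ᶠ x : OK ⧸ Ideal.span {c}, eC (((A * rep x ^ 3 + B * rep x : OK) : ℂ) / (c : ℂ))

/-- The cubic residue symbol `(x/π)₃` for a prime element `π` not dividing `3`:
the unique cube root of unity congruent to `x^{(N(π)-1)/3}` mod `π`, and `0` if `π ∣ x`. -/
def cubicCharP (π x : OK) : OK :=
  if h : ∃ ζ : OK, ζ ^ 3 = 1 ∧ π ∣ ζ - x ^ ((Nm π - 1) / 3) ∧ ¬ π ∣ x then h.choose else 0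

/-- The cubic residue symbol `(x/c)₃` for `c` coprime to `3`, defined via a factorization of
`c` into a unit times prime elements (with multiplicity). -/
def cubicChar (c x : OK) : OK :=
  if h : ∃ fs : OKˣ × Multiset OK, (∀ π ∈ fs.2, Prime π) ∧ c = (fs.1 : OK) * fs.2.prod
  then (h.choose.2.map fun π => cubicCharP π x).prod
  else 0

/-- The cubic Gauss sum `g(a,c) = ∑_{x (c)*} (x/c)₃ e(ax/c)`. -/
def gaussSum (a c : OK) : ℂ :=
  ∑ᶠ u : (OK ⧸ Ideal.span {c})ˣ,
    ((cubicChar c (rep u.val) : OK) : ℂ) * eC (((a * rep u.val : OK) : ℂ) / (c : ℂ))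

/-- The Möbius function: `μ(c) = (−1)^r` if `(c)` is a product of `r` distinct prime ideals,
and `μ(c) = 0` otherwise. -/
def moebius (c : OK) : ℤ :=
  if h : ∃ s : Finset (Ideal OK), (∀ P ∈ s, Prime P) ∧ Ideal.span {c} = ∏ P ∈ s, P
  then (-1) ^ h.choose.card
  else 0

/-- `p^n` modulo `c`, where a negative exponent means the inverse of `p^{-n}` mod `c`. -/
def ppow (c p : OK) (n : ℤ) : OK :=
  if 0 ≤ n then p ^ n.toNat else invMod c (p ^ (-n).toNat)

/-- A choice of generator of a (principal) ideal. -/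
def gen (J : Ideal OK) : OK := if h : ∃ q : OK, Ideal.span {q} = J then h.choose else 0

/-- A choice of cofactor: `cofactor c q` is a `d` with `c = q·d`, when one exists. -/
def cofactor (c q : OK) : OK := if h : ∃ d : OK, c = q * d then h.choose else 0


/-- The sum `S(j,k)` of Statement 8. -/
def S8 (p w B : OK) (j k : ℕ) : ℂ :=
  ∑ᶠ u : (OK ⧸ Ideal.span {p ^ k})ˣ,
    ((cubicCharP p (rep u.val) ^ k : OK) : ℂ) *
      eC (((p * invMod (p ^ k) (w * rep u.val) : OK) : ℂ) / ((p ^ k : OK) : ℂ)) *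
      ∑ᶠ t : OK ⧸ Ideal.span {p ^ k},
        eC (((rep u.val * w ^ 2 * rep t ^ 3 + p ^ j * B * rep t : OK) : ℂ) /
          ((p ^ k : OK) : ℂ))


theorem om_sq : ω ^ 2 = -1 - ω := by
  have h := Complex.isPrimitiveRoot_exp 3 (by norm_num)
  have h1 : (Complex.exp (2 * Real.pi * Complex.I / (3 : ℕ))) = ω := by simp [ω]
  rw [h1] at h
  have h3 := h.pow_eq_one
  have hne := h.ne_one (by norm_num)
  have : (ω - 1) * (ω ^ 2 + ω + 1) = 0 := by linear_combination h3
  rcases mul_eq_zero.1 this with h | h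
  · exact absurd (sub_eq_zero.1 h) hne
  · linear_combination h

theorem om_cube : ω ^ 3 = 1 := by linear_combination (ω - 1) * om_sq

theorem om_im_ne : δ ≠ 0 := by
  intro h
  have h2 : δ ^ 2 = -3 := by
    unfold δ
    linear_combination (ω ^ 2 - 3 * ω + 3) * om_sq
  rw [h] at h2
  norm_num at h2

theorem om_conj : (starRingEnd ℂ) ω = ω ^ 2 := by
  have hω : ω ≠ 0 := by
    intro h
    have := om_cube
    rw [h] at this
    norm_num at this
  have h1 : (starRingEnd ℂ) ω * ω = 1 := by
    unfold ω
    rw [← Complex.exp_conj, ← Complex.exp_add]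
    rw [Complex.exp_eq_one_iff]
    refine ⟨0, ?_⟩
    simp only [map_div₀, map_mul, Complex.conj_ofReal, Complex.conj_I, map_ofNat]
    push_cast
    ring
  have h2 : ω ^ 2 * ω = 1 := by linear_combination om_cube
  exact mul_right_cancel₀ hω (h1.trans h2.symm)

theorem eC_coord (x y : ℝ) :
    eC ((x : ℂ) + y * ω) = Complex.exp (2 * Real.pi * Complex.I * y) := by
  unfold eC
  congr 2
  have hc : (starRingEnd ℂ) δ = - δ := by
    unfold δ
    rw [map_sub, map_pow, om_conj]
    linear_combination -ω * om_cube
  rw [map_div₀, hc, map_add, map_mul, om_conj, Complex.conj_ofReal, Complex.conj_ofReal]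
  have := om_im_ne
  field_simp
  unfold δ
  ring

theorem eC_add (a b : ℂ) : eC (a + b) = eC a * eC b := by
  unfold eC
  rw [← Complex.exp_add]
  congr 1
  rw [add_div, map_add]
  ring

def om : OK := ⟨ω, Subring.subset_closure rfl⟩

theorem om_coe : (om : ℂ) = ω := rfl

theorem om_sq' : om ^ 2 = -1 - om := by
  apply Subtype.ext
  push_cast
  exact om_sq

theorem OK_coord (a : OK) : ∃ m n : ℤ, a = m + n * om := by
  obtain ⟨a, ha⟩ := a
  induction ha using Subring.closure_induction with
  | mem x hx =>
    refine ⟨0, 1, ?_⟩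
    apply Subtype.ext
    rw [Set.mem_singleton_iff] at hx
    simp [om, hx]
  | zero => exact ⟨0, 0, by apply Subtype.ext; simp⟩
  | one => exact ⟨1, 0, by apply Subtype.ext; simp⟩
  | add x y hx hy h1 h2 =>
    obtain ⟨m, n, h⟩ := h1
    obtain ⟨m', n', h'⟩ := h2
    refine ⟨m + m', n + n', ?_⟩
    have : (⟨x + y, add_mem hx hy⟩ : OK) = ⟨x, hx⟩ + ⟨y, hy⟩ := rfl
    rw [this, h, h']
    push_cast
    ring
  | neg x hx h1 =>
    obtain ⟨m, n, h⟩ := h1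
    refine ⟨-m, -n, ?_⟩
    have : (⟨-x, neg_mem hx⟩ : OK) = -⟨x, hx⟩ := rfl
    rw [this, h]
    push_cast
    ring
  | mul x y hx hy h1 h2 =>
    obtain ⟨m, n, h⟩ := h1
    obtain ⟨m', n', h'⟩ := h2
    refine ⟨m * m' - n * n', m * n' + n * m' - n * n', ?_⟩
    have : (⟨x * y, mul_mem hx hy⟩ : OK) = ⟨x, hx⟩ * ⟨y, hy⟩ := rfl
    rw [this, h, h']
    push_cast
    linear_combination (n * n' : OK) * om_sq'

theorem eC_OK (a : OK) : eC (a : ℂ) = 1 := by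
  obtain ⟨m, n, rfl⟩ := OK_coord a
  have := eC_coord m n
  push_cast at this ⊢
  rw [om_coe, this, Complex.exp_eq_one_iff]
  exact ⟨n, by ring⟩

theorem exists_coord (z : ℂ) : ∃ x y : ℝ, z = x + y * ω := by
  have him : ω.im ≠ 0 := by
    intro h
    have h1 := om_sq
    have h2 : ω = (ω.re : ℂ) := by apply Complex.ext <;> simp [h]
    have h3 : (ω.re) ^ 2 = -1 - ω.re := by
      rw [h2] at h1
      exact_mod_cast h1
    nlinarith [sq_nonneg (ω.re + 1 / 2)]
  refine ⟨z.re - z.im / ω.im * ω.re, z.im / ω.im, ?_⟩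
  apply Complex.ext
  · simp
  · simp
    field_simp

theorem mem_O_of_eC (z : ℂ) (h : ∀ a : OK, eC ((a : ℂ) * z) = 1) : ∃ b : OK, (b : ℂ) = z := by
  obtain ⟨x, y, rfl⟩ := exists_coord z
  have key : ∀ t : ℝ, Complex.exp (2 * Real.pi * Complex.I * t) = 1 → ∃ n : ℤ, t = n := by
    intro t ht
    rw [Complex.exp_eq_one_iff] at ht
    obtain ⟨n, hn⟩ := ht
    refine ⟨n, ?_⟩
    have h2 : (2 * Real.pi * Complex.I : ℂ) ≠ 0 := Complex.two_pi_I_ne_zero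
    have : (t : ℂ) = n := by
      apply mul_left_cancel₀ h2
      rw [hn]
      ring
    exact_mod_cast this
  have h1 := h 1
  have h2 := h om
  have e1 : (((1 : OK) : ℂ) * ((x : ℂ) + y * ω)) = (x : ℂ) + y * ω := by simp
  have e2 : ((om : ℂ) * ((x : ℂ) + y * ω)) = ((-y : ℝ) : ℂ) + ((x - y : ℝ) : ℂ) * ω := by
    rw [om_coe]
    push_cast
    linear_combination (y : ℂ) * om_sq
  rw [e1, eC_coord] at h1
  rw [e2, eC_coord] at h2
  obtain ⟨n, hn⟩ := key _ h1
  obtain ⟨m, hm⟩ := key _ h2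
  have hx : x = ((m + n : ℤ) : ℝ) := by push_cast; linarith
  refine ⟨((m + n : ℤ) : OK) + (n : OK) * om, ?_⟩
  rw [hx, hn]
  push_cast
  rw [om_coe]

instance : Module.Finite ℤ OK := by
  refine ⟨⟨{1, om}, ?_⟩⟩
  rw [eq_top_iff]
  rintro a -
  obtain ⟨m, n, rfl⟩ := OK_coord a
  simp only [Finset.coe_insert, Finset.coe_singleton]
  rw [Submodule.mem_span_pair]
  exact ⟨m, n, by simp⟩

theorem finQ (c : OK) (hc : c ≠ 0) : Finite (OK ⧸ Ideal.span {c}) := by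
  have : Module.Free ℤ OK := inferInstance
  apply Ideal.finiteQuotientOfFreeOfNeBot
  simpa [Ideal.span_singleton_eq_bot] using hc

theorem mk_rep {I : Ideal OK} (x : OK ⧸ I) : Ideal.Quotient.mk I (rep x) = x :=
  Function.surjInv_eq _ x

theorem mk_eq_iff (c a b : OK) :
    Ideal.Quotient.mk (Ideal.span {c}) a = Ideal.Quotient.mk (Ideal.span {c}) b ↔ c ∣ a - b := by
  rw [Ideal.Quotient.eq, Ideal.mem_span_singleton]

theorem mk_zero_iff (c a : OK) :
    Ideal.Quotient.mk (Ideal.span {c}) a = 0 ↔ c ∣ a := by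
  rw [Ideal.Quotient.eq_zero_iff_dvd]

theorem eC_congr (c a b : OK) (hc : c ≠ 0)
    (h : Ideal.Quotient.mk (Ideal.span {c}) a = Ideal.Quotient.mk (Ideal.span {c}) b) :
    eC ((a : ℂ) / c) = eC ((b : ℂ) / c) := by
  rw [mk_eq_iff] at h
  obtain ⟨d, hd⟩ := h
  have hc' : (c : ℂ) ≠ 0 := by simpa using hc
  have : (a : ℂ) / c = b / c + d := by
    field_simp
    have : a = b + c * d := by linear_combination hd
    rw [this]
    push_cast
    ring
  rw [this, eC_add, eC_OK, mul_one]

/-- The additive character of `OK/(c)`. -/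
def E (c : OK) (hc : c ≠ 0) : AddChar (OK ⧸ Ideal.span {c}) ℂ where
  toFun x := eC ((rep x : ℂ) / c)
  map_zero_eq_one' := by
    have := eC_congr c (rep (0 : OK ⧸ Ideal.span {c})) 0 hc (by rw [mk_rep]; simp)
    rw [this]
    have h := eC_OK 0
    simpa using h
  map_add_eq_mul' x y := by
    have := eC_congr c (rep (x + y)) (rep x + rep y) hc (by rw [mk_rep, map_add, mk_rep, mk_rep])
    rw [this, ← eC_add]
    push_cast
    rw [add_div]

theorem E_mk (c : OK) (hc : c ≠ 0) (a : OK) :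
    eC ((a : ℂ) / c) = E c hc (Ideal.Quotient.mk _ a) := by
  change _ = eC _
  exact eC_congr c _ _ hc (by rw [mk_rep])

theorem E_ne (p : OK) (hp : Prime p) : E p hp.ne_zero ≠ 1 := by
  intro h
  have hc' : (p : ℂ) ≠ 0 := by simpa using hp.ne_zero
  obtain ⟨b, hb⟩ := mem_O_of_eC ((p : ℂ)⁻¹) (by
    intro a
    rw [← div_eq_mul_inv, E_mk p hp.ne_zero, h]
    rfl)
  apply hp.not_isUnit
  apply IsUnit.of_mul_eq_one b
  apply Subtype.ext
  push_cast
  rw [hb]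
  field_simp

theorem E_pow (p : OK) (hp : p ≠ 0) (k : ℕ) (a : OK) :
    E (p ^ (k + 1)) (pow_ne_zero _ hp) (Ideal.Quotient.mk _ (p ^ k * a)) =
      E p hp (Ideal.Quotient.mk _ a) := by
  rw [← E_mk, ← E_mk]
  have hc' : (p : ℂ) ≠ 0 := by simpa using hp
  congr 1
  push_cast
  field_simp
  ring

theorem not_dvd_three (p : OK) (hp : Prime p) (hp3 : (3 : OK) ∣ p - 1) : ¬ p ∣ 3 := by
  rintro h
  apply hp.not_isUnit
  apply isUnit_of_dvd_one
  obtain ⟨m, hm⟩ := hp3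
  have : (1 : OK) = p - 3 * m := by linear_combination -hm
  rw [this]
  exact dvd_sub dvd_rfl (h.mul_right m)

theorem cube_root_unique (p : OK) (hp : Prime p) (hp3 : (3 : OK) ∣ p - 1) (a b : OK)
    (ha : a ^ 3 = 1) (hb : b ^ 3 = 1) (h : p ∣ a - b) : a = b := by
  by_contra hne
  have h0 : (a - b) * (a ^ 2 + a * b + b ^ 2) = 0 := by linear_combination ha - hb
  have h1 := (mul_eq_zero.1 h0).resolve_left (sub_ne_zero.2 hne)
  apply not_dvd_three p hp hp3
  have : (3 : OK) = (a - b) * (-(a + 2 * b) * b) := by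
    linear_combination -3 * hb + b * h1
  rw [this]
  exact h.mul_right _

theorem isMax (p : OK) (hp : Prime p) : (Ideal.span {p}).IsMaximal := by
  have := finQ p hp.ne_zero
  have hpr : (Ideal.span {p}).IsPrime := (Ideal.span_singleton_prime hp.ne_zero).2 hp
  apply Ideal.Quotient.maximal_of_isField
  exact Finite.isField_of_domain _

/-- Facts about a finite field with a primitive cube root of unity. -/
theorem field_facts (F : Type*) [Field F] [Finite F] (o : F) (ho : o ^ 2 = -1 - o)
    (h3 : (3 : F) ≠ 0) :
    (∀ y : F, y ≠ 0 → (y ^ ((Nat.card F - 1) / 3)) ^ 3 = 1) ∧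
    ∃ y : F, y ≠ 0 ∧ y ^ ((Nat.card F - 1) / 3) ≠ 1 := by
  have o3 : o ^ 3 = 1 := by linear_combination (o - 1) * ho
  have o1 : o ≠ 1 := by
    rintro rfl
    apply h3
    linear_combination ho
  have o0 : o ≠ 0 := by
    rintro rfl
    norm_num at o3
  have hord : orderOf (Units.mk0 o o0) = 3 := by
    have : Fact (Nat.Prime 3) := ⟨by norm_num⟩
    apply orderOf_eq_prime
    · ext
      simpa using o3
    · intro h
      apply o1
      simpa using congrArg Units.val h
  have hc : Nat.card Fˣ = Nat.card F - 1 := Nat.card_units F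
  have hdvd : 3 ∣ Nat.card F - 1 := by
    rw [← hc, ← hord]
    exact orderOf_dvd_natCard _
  constructor
  · intro y hy
    rw [← pow_mul, Nat.div_mul_cancel hdvd, ← hc]
    have : (Units.mk0 y hy) ^ (Nat.card Fˣ) = 1 := pow_card_eq_one'
    have h2 := congrArg Units.val this
    rwa [Units.val_pow_eq_pow_val] at h2
  · obtain ⟨g, hg⟩ := IsCyclic.exists_generator (α := Fˣ)
    refine ⟨g, g.ne_zero, ?_⟩
    intro h
    have h1 : g ^ ((Nat.card F - 1) / 3) = 1 := by
      ext
      simpa using h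
    have h2 := orderOf_dvd_of_pow_eq_one h1
    rw [orderOf_eq_card_of_forall_mem_zpowers hg, hc] at h2
    have hpos : 0 < Nat.card F - 1 := by
      rw [← hc]
      exact Nat.card_pos
    have := Nat.le_of_dvd (Nat.div_pos (Nat.le_of_dvd hpos hdvd) (by norm_num)) h2
    omega

theorem facts_p (p : OK) (hp : Prime p) (hp3 : (3 : OK) ∣ p - 1) :
    (∀ y : OK, ¬ p ∣ y → p ∣ (y ^ ((Nm p - 1) / 3)) ^ 3 - 1) ∧
    ∃ y : OK, ¬ p ∣ y ∧ ¬ p ∣ y ^ ((Nm p - 1) / 3) - 1 := by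
  have := isMax p hp
  have := finQ p hp.ne_zero
  let : Field (OK ⧸ Ideal.span {p}) := Ideal.Quotient.field _
  have h := field_facts (OK ⧸ Ideal.span {p}) (Ideal.Quotient.mk _ om)
    (by rw [← map_pow, om_sq']; simp)
    (by
      intro h
      apply not_dvd_three p hp hp3
      rw [← mk_zero_iff]
      rw [map_ofNat]
      exact h)
  obtain ⟨h1, y, hy, h2⟩ := h
  constructor
  · intro y hy
    rw [← mk_eq_iff, map_pow, map_pow, map_one]
    apply h1
    rw [Ne, mk_zero_iff]
    exact hy
  · obtain ⟨y, rfl⟩ := Ideal.Quotient.mk_surjective y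
    refine ⟨y, ?_, ?_⟩
    · rwa [← mk_zero_iff]
    · rw [← mk_eq_iff, map_pow, map_one]
      exact h2

theorem char_exists (p : OK) (hp : Prime p) (hp3 : (3 : OK) ∣ p - 1) (x : OK) (hx : ¬ p ∣ x) :
    ∃ ζ : OK, ζ ^ 3 = 1 ∧ p ∣ ζ - x ^ ((Nm p - 1) / 3) ∧ ¬ p ∣ x := by
  have h := (facts_p p hp hp3).1 x hx
  set y := x ^ ((Nm p - 1) / 3)
  have o3 : om ^ 3 = 1 := by linear_combination (om - 1) * om_sq'
  have e : y ^ 3 - 1 = (1 - y) * ((om - y) * (om ^ 2 - y)) * (-1) := by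
    linear_combination (1 - y) * o3 + (y ^ 2 - y) * om_sq'
  rw [e, mul_neg_one, dvd_neg] at h
  rcases hp.dvd_or_dvd h with h | h
  · exact ⟨1, one_pow _, h, hx⟩
  rcases hp.dvd_or_dvd h with h | h
  · exact ⟨om, o3, h, hx⟩
  · exact ⟨om ^ 2, by rw [← pow_mul, mul_comm, pow_mul, o3, one_pow], h, hx⟩

theorem char_spec (p : OK) (hp : Prime p) (hp3 : (3 : OK) ∣ p - 1) (x : OK) (hx : ¬ p ∣ x) :
    cubicCharP p x ^ 3 = 1 ∧ p ∣ cubicCharP p x - x ^ ((Nm p - 1) / 3) := by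
  have h := char_exists p hp hp3 x hx
  unfold cubicCharP
  rw [dif_pos h]
  exact ⟨h.choose_spec.1, h.choose_spec.2.1⟩

theorem char_zero (p : OK) (x : OK) (hx : p ∣ x) : cubicCharP p x = 0 := by
  unfold cubicCharP
  rw [dif_neg]
  rintro ⟨_, _, _, h⟩
  exact h hx

theorem char_unique (p : OK) (hp : Prime p) (hp3 : (3 : OK) ∣ p - 1) (x : OK) (hx : ¬ p ∣ x)
    (ζ : OK) (h3 : ζ ^ 3 = 1) (h : p ∣ ζ - x ^ ((Nm p - 1) / 3)) : cubicCharP p x = ζ := by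
  have hs := char_spec p hp hp3 x hx
  apply cube_root_unique p hp hp3 _ _ hs.1 h3
  have := dvd_sub hs.2 h
  rwa [sub_sub_sub_cancel_right] at this

theorem char_congr (p : OK) (hp : Prime p) (hp3 : (3 : OK) ∣ p - 1) (x y : OK) (h : p ∣ x - y) :
    cubicCharP p x = cubicCharP p y := by
  by_cases hx : p ∣ x
  · have hy : p ∣ y := by
      have := dvd_sub hx h
      rwa [sub_sub_cancel] at this
    rw [char_zero p x hx, char_zero p y hy]
  · have hy : ¬ p ∣ y := by
      intro hy
      apply hx
      have := dvd_add h hy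
      rwa [sub_add_cancel] at this
    have hs := char_spec p hp hp3 y hy
    apply char_unique p hp hp3 x hx _ hs.1
    rw [← mk_eq_iff] at hs h ⊢
    rw [hs.2, map_pow, map_pow, h]

theorem char_mul (p : OK) (hp : Prime p) (hp3 : (3 : OK) ∣ p - 1) (x y : OK) :
    cubicCharP p (x * y) = cubicCharP p x * cubicCharP p y := by
  by_cases hx : p ∣ x
  · rw [char_zero p x hx, char_zero p _ (hx.mul_right y), zero_mul]
  by_cases hy : p ∣ y
  · rw [char_zero p y hy, char_zero p _ (hy.mul_left x), mul_zero]
  have h1 := char_spec p hp hp3 x hx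
  have h2 := char_spec p hp hp3 y hy
  apply char_unique p hp hp3
  · exact fun h => (hp.dvd_or_dvd h).elim hx hy
  · rw [mul_pow, h1.1, h2.1, one_mul]
  · rw [← mk_eq_iff] at h1 h2 ⊢
    rw [map_mul, h1.2, h2.2, mul_pow, map_mul]

theorem char_one (p : OK) (hp : Prime p) (hp3 : (3 : OK) ∣ p - 1) : cubicCharP p 1 = 1 := by
  apply char_unique p hp hp3
  · exact fun h => hp.not_isUnit (isUnit_of_dvd_one h)
  · simp
  · simp

theorem char_nontriv (p : OK) (hp : Prime p) (hp3 : (3 : OK) ∣ p - 1) :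
    ∃ y, ¬ p ∣ y ∧ cubicCharP p y ≠ 1 := by
  obtain ⟨y, hy, h⟩ := (facts_p p hp hp3).2
  refine ⟨y, hy, ?_⟩
  intro h1
  have := (char_spec p hp hp3 y hy).2
  rw [h1] at this
  apply h
  rwa [← dvd_neg, neg_sub]

theorem cubicChar_eq (p : OK) (hp : Prime p) (x : OK) : cubicChar p x = cubicCharP p x := by
  have h : ∃ fs : OKˣ × Multiset OK, (∀ π ∈ fs.2, Prime π) ∧ p = (fs.1 : OK) * fs.2.prod := by
    refine ⟨(1, {p}), ?_, ?_⟩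
    · simpa using hp
    · simp
  unfold cubicChar
  rw [dif_pos h]
  obtain ⟨h1, h2⟩ := h.choose_spec
  set fs := h.choose
  have hrel : Multiset.Rel Associated fs.2 {p} := by
    apply prime_factors_unique h1 (by simpa using hp)
    refine ⟨fs.1, ?_⟩
    rw [Multiset.prod_singleton, mul_comm]
    exact h2.symm
  obtain ⟨a, ha, hfs⟩ : ∃ a, Associated a p ∧ fs.2 = {a} := by
    have hc := Multiset.card_eq_card_of_rel hrel
    rw [Multiset.card_singleton, Multiset.card_eq_one] at hc
    obtain ⟨a, ha⟩ := hc
    refine ⟨a, ?_, ha⟩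
    rw [ha] at hrel
    simpa [Multiset.rel_cons_left, ← Multiset.cons_zero] using hrel
  rw [hfs]
  simp only [Multiset.map_singleton, Multiset.prod_singleton]
  have hN : Nm a = Nm p := by
    unfold Nm
    rw [Ideal.span_singleton_eq_span_singleton.2 ha]
  have hd : ∀ y, a ∣ y ↔ p ∣ y := fun y => ha.dvd_iff_dvd_left
  unfold cubicCharP
  simp only [hN, hd]

/-- The cubic residue character as a multiplicative character. -/
def chi (p : OK) (hp : Prime p) (hp3 : (3 : OK) ∣ p - 1) :
    MulChar (OK ⧸ Ideal.span {p}) ℂ where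
  toFun x := ((cubicCharP p (rep x) : OK) : ℂ)
  map_one' := by
    rw [char_congr p hp hp3 _ 1 (by rw [← mk_eq_iff, mk_rep, map_one]), char_one p hp hp3]
    rfl
  map_mul' x y := by
    rw [char_congr p hp hp3 _ (rep x * rep y)
      (by rw [← mk_eq_iff, map_mul, mk_rep, mk_rep, mk_rep]), char_mul p hp hp3]
    rfl
  map_nonunit' x hx := by
    rw [char_zero]
    · rfl
    · by_contra h
      apply hx
      have := isMax p hp
      let : Field (OK ⧸ Ideal.span {p}) := Ideal.Quotient.field _
      apply Ne.isUnit (G₀ := OK ⧸ Ideal.span {p})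
      intro h0
      apply h
      rw [← mk_zero_iff, mk_rep, h0]

theorem chi_mk (p : OK) (hp : Prime p) (hp3 : (3 : OK) ∣ p - 1) (a : OK) :
    ((cubicCharP p a : OK) : ℂ) = chi p hp hp3 (Ideal.Quotient.mk _ a) := by
  change _ = ((cubicCharP p (rep _) : OK) : ℂ)
  rw [char_congr p hp hp3 a]
  rw [← mk_eq_iff, mk_rep]

theorem chi_ne (p : OK) (hp : Prime p) (hp3 : (3 : OK) ∣ p - 1) : chi p hp hp3 ≠ 1 := by
  intro h
  obtain ⟨y, hy, hne⟩ := char_nontriv p hp hp3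
  apply hne
  apply Subtype.ext
  rw [chi_mk p hp hp3, h]
  have := isMax p hp
  let : Field (OK ⧸ Ideal.span {p}) := Ideal.Quotient.field _
  rw [MulChar.one_apply]
  · rfl
  · apply Ne.isUnit (G₀ := OK ⧸ Ideal.span {p})
    rwa [Ne, mk_zero_iff]

theorem chi_cube (p : OK) (hp : Prime p) (hp3 : (3 : OK) ∣ p - 1)
    (u : (OK ⧸ Ideal.span {p})ˣ) : chi p hp hp3 u ^ 3 = 1 := by
  obtain ⟨a, ha⟩ := Ideal.Quotient.mk_surjective u.val
  rw [← ha, ← chi_mk]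
  have hpa : ¬ p ∣ a := by
    rw [← mk_zero_iff, ha]
    have := isMax p hp
    let : Field (OK ⧸ Ideal.span {p}) := Ideal.Quotient.field _
    exact u.ne_zero
  have := (char_spec p hp hp3 a hpa).1
  exact_mod_cast congrArg Subtype.val this

theorem sum_chi_shift {F : Type*} [CommRing F] [Fintype Fˣ] (χ : MulChar F ℂ)
    (ψ : AddChar F ℂ) (h3 : ∀ u : Fˣ, χ u ^ 3 = 1) (c : Fˣ) :
    ∑ v : Fˣ, χ v * ψ (v * c) = χ c ^ 2 * ∑ v : Fˣ, χ v * ψ v := by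
  rw [Finset.mul_sum, ← Equiv.sum_comp (Equiv.mulRight c)
    (fun v : Fˣ => χ c ^ 2 * (χ v * ψ v))]
  apply Finset.sum_congr rfl
  intro v _
  simp only [Equiv.coe_mulRight, Units.val_mul, map_mul]
  linear_combination -(χ v * ψ (v * c)) * h3 c

theorem sum_k1 {F : Type*} [Field F] [Fintype F] [Fintype Fˣ] (χ : MulChar F ℂ)
    (ψ : AddChar F ℂ) (h3 : ∀ u : Fˣ, χ u ^ 3 = 1) (h1 : χ ≠ 1) (w : Fˣ) :
    ∑ v : Fˣ, χ v * ∑ t : F, ψ (v * w ^ 2 * t ^ 3) =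
      (Nat.card Fˣ : ℂ) * χ w * ∑ v : Fˣ, χ v * ψ v := by
  classical
  simp_rw [Finset.mul_sum]
  rw [Finset.sum_comm]
  have hsum : ∑ v : Fˣ, χ v = 0 := by
    have h := MulChar.sum_eq_zero_of_ne_one h1
    rw [← h]
    have := Finset.sum_subset (Finset.subset_univ (Finset.univ.image (fun v : Fˣ => (v : F))))
      (f := fun a => χ a) (by
        intro x _ hx
        apply χ.map_nonunit
        rintro ⟨u, rfl⟩
        apply hx
        exact Finset.mem_image_of_mem _ (Finset.mem_univ _))
    rw [← this, Finset.sum_image]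
    intro a _ b _ hab
    exact Units.ext hab
  have hin : ∀ t : F, ∑ v : Fˣ, χ v * ψ (v * w ^ 2 * t ^ 3) =
      if t = 0 then 0 else χ w * ∑ v : Fˣ, χ v * ψ v := by
    intro t
    split_ifs with ht
    · subst ht
      simpa using hsum
    · have := sum_chi_shift χ ψ h3 (w ^ 2 * (Units.mk0 t ht) ^ 3)
      have ht3 := h3 (Units.mk0 t ht)
      have hw3 := h3 w
      simp only [Units.val_mul, Units.val_pow_eq_pow_val, Units.val_mk0, map_mul, map_pow] at this ht3
      simp_rw [← mul_assoc] at this ⊢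
      rw [this, ht3]
      linear_combination χ w * (∑ v : Fˣ, χ v * ψ v) * hw3
  simp_rw [hin]
  rw [← Finset.sum_filter_add_sum_filter_not Finset.univ (fun t : F => t = 0)]
  rw [Finset.sum_congr rfl (g := fun _ => (0 : ℂ)) (by
    intro x hx
    rw [if_pos (Finset.mem_filter.1 hx).2])]
  rw [Finset.sum_congr rfl (g := fun _ => χ w * ∑ v : Fˣ, χ v * ψ v)
    (s₁ := Finset.univ.filter (fun t : F => ¬ t = 0)) (by
    intro x hx
    rw [if_neg (Finset.mem_filter.1 hx).2])]
  have hcard : (Finset.univ.filter (fun t : F => ¬ t = 0)).card = Nat.card Fˣ := by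
    rw [Nat.card_congr unitsEquivNeZero, Nat.card_eq_fintype_card, Fintype.card_subtype]
  rw [Finset.sum_const, Finset.sum_const, hcard]
  simp only [nsmul_eq_mul, ← Finset.mul_sum]
  ring

theorem sum_k2 {F : Type*} [CommRing F] [Fintype Fˣ] (χ : MulChar F ℂ)
    (ψ : AddChar F ℂ) (h3 : ∀ u : Fˣ, χ u ^ 3 = 1) (w : Fˣ) :
    ∑ v : Fˣ, χ v ^ 2 * ψ (w⁻¹ * v⁻¹ : Fˣ) = χ w * ∑ v : Fˣ, χ v * ψ v := by
  rw [Finset.mul_sum, ← Equiv.sum_comp ((Equiv.inv Fˣ).trans (Equiv.mulRight w⁻¹))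
    (fun v : Fˣ => χ w * (χ v * ψ v))]
  apply Finset.sum_congr rfl
  intro v _
  simp only [Equiv.coe_mulRight, Equiv.trans_apply, Equiv.inv_apply, Units.val_mul, map_mul]
  have hv : χ v * χ (v⁻¹ : Fˣ) = 1 := by rw [← map_mul]; simp
  have hw : χ w * χ (w⁻¹ : Fˣ) = 1 := by rw [← map_mul]; simp
  have e : χ v ^ 2 = χ (v⁻¹ : Fˣ) := by
    linear_combination χ (v⁻¹ : Fˣ) * h3 v - χ v ^ 2 * hv
  rw [e, mul_comm (w⁻¹ : Fˣ).val]
  linear_combination -(χ (v⁻¹ : Fˣ) * ψ ((v⁻¹ : Fˣ) * (w⁻¹ : Fˣ))) * hw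

theorem sum_psi {F : Type*} [Field F] [Fintype F] (ψ : AddChar F ℂ) (h : ψ ≠ 1) (c : F)
    (hc : c ≠ 0) : ∑ t, ψ (c * t) = 0 := by
  rw [← AddChar.sum_eq_zero_of_ne_one h]
  exact Equiv.sum_comp (Equiv.mulLeft₀ c hc) (fun t => ψ t)

theorem vanish {G T : Type*} [Group G] [Fintype G] [Fintype T] [Nonempty T] (f : G → ℂ)
    (v : T → G) (h : ∀ g, ∑ t, f (g * v t) = 0) : ∑ g, f g = 0 := by
  have h1 : ∀ t : T, ∑ g, f (g * v t) = ∑ g, f g := fun t =>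
    Equiv.sum_comp (Equiv.mulRight (v t)) f
  have h2 : ∑ t : T, ∑ g, f (g * v t) = 0 := by
    rw [Finset.sum_comm]
    exact Finset.sum_eq_zero fun g _ => h g
  simp_rw [h1] at h2
  rw [Finset.sum_const, nsmul_eq_mul] at h2
  rcases mul_eq_zero.1 h2 with h3 | h3
  · simp at h3
  · exact h3

theorem sum_fib {G H : Type*} [Group G] [Group H] [Fintype G] [Fintype H] [DecidableEq H]
    (f : G →* H) (hf : Function.Surjective f) (h : H → ℂ) :
    ∑ g, h (f g) = ((Finset.univ.filter (fun g => f g = 1)).card : ℂ) * ∑ b, h b := by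
  rw [← Finset.sum_fiberwise Finset.univ f, Finset.mul_sum]
  apply Finset.sum_congr rfl
  intro b _
  rw [Finset.sum_congr rfl (g := fun _ => h b) (by
    intro x hx
    rw [(Finset.mem_filter.1 hx).2])]
  rw [Finset.sum_const, nsmul_eq_mul]
  congr 2
  obtain ⟨g, rfl⟩ := hf b
  apply Finset.card_bij (fun x _ => g⁻¹ * x)
  · intro x hx
    simp only [Finset.mem_filter, Finset.mem_univ, true_and] at hx ⊢
    rw [map_mul, map_inv, hx, inv_mul_cancel]
  · intro a _ b _ hab
    exact mul_left_cancel hab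
  · intro y hy
    simp only [Finset.mem_filter, Finset.mem_univ, true_and] at hy
    refine ⟨g * y, ?_, by simp⟩
    simp [hy]

/-- Reduction modulo `p`. -/
def red (p c : OK) (h : p ∣ c) : (OK ⧸ Ideal.span {c}) →+* (OK ⧸ Ideal.span {p}) :=
  Ideal.Quotient.factor (Ideal.span_singleton_le_span_singleton.2 h)

theorem red_mk (p c : OK) (h : p ∣ c) (a : OK) :
    red p c h (Ideal.Quotient.mk _ a) = Ideal.Quotient.mk _ a := rfl

theorem red_surj (p c : OK) (h : p ∣ c) : Function.Surjective (red p c h) := by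
  intro y
  obtain ⟨a, rfl⟩ := Ideal.Quotient.mk_surjective y
  exact ⟨Ideal.Quotient.mk _ a, rfl⟩

theorem red_zero (p c : OK) (h : p ∣ c) (x : OK ⧸ Ideal.span {c}) (hx : red p c h x = 0) :
    ∃ y, x = Ideal.Quotient.mk _ p * y := by
  obtain ⟨a, rfl⟩ := Ideal.Quotient.mk_surjective x
  rw [red_mk, mk_zero_iff] at hx
  obtain ⟨b, rfl⟩ := hx
  exact ⟨Ideal.Quotient.mk _ b, by rw [map_mul]⟩

theorem S_eq (p w B c : OK) (hp : Prime p) (hp3 : (3 : OK) ∣ p - 1) (hc : c ≠ 0) (hpc : p ∣ c)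
    (j k : ℕ) [Fintype (OK ⧸ Ideal.span {c})] [Fintype (OK ⧸ Ideal.span {c})ˣ]
    (W : (OK ⧸ Ideal.span {c})ˣ) (hW : W.val = Ideal.Quotient.mk (Ideal.span {c}) w) :
    (∑ᶠ u : (OK ⧸ Ideal.span {c})ˣ,
      ((cubicCharP p (rep u.val) ^ k : OK) : ℂ) *
        eC (((p * invMod c (w * rep u.val) : OK) : ℂ) / ((c : OK) : ℂ)) *
        ∑ᶠ t : OK ⧸ Ideal.span {c},
          eC (((rep u.val * w ^ 2 * rep t ^ 3 + p ^ j * B * rep t : OK) : ℂ) /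
            ((c : OK) : ℂ))) =
    ∑ u : (OK ⧸ Ideal.span {c})ˣ, chi p hp hp3 (red p c hpc u) ^ k *
      E c hc (Ideal.Quotient.mk (Ideal.span {c}) p * (W⁻¹ * u⁻¹ : (OK ⧸ Ideal.span {c})ˣ).val) *
      ∑ t : OK ⧸ Ideal.span {c},
        E c hc (u.val * W.val ^ 2 * t ^ 3 + Ideal.Quotient.mk (Ideal.span {c}) (p ^ j * B) * t) := by
  rw [finsum_eq_sum_of_fintype]
  apply Finset.sum_congr rfl
  intro u _
  rw [finsum_eq_sum_of_fintype]
  congr 1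
  · congr 1
    · rw [SubmonoidClass.coe_pow, chi_mk p hp hp3]
      congr 2
      rw [← red_mk p c hpc, mk_rep]
    · rw [E_mk c hc, map_mul]
      congr 2
      unfold invMod
      rw [mk_rep, map_mul, mk_rep, ← hW, ← Units.val_mul, Ring.inverse_unit, mul_inv_rev,
        Units.val_mul, Units.val_mul, mul_comm]
  · apply Finset.sum_congr rfl
    intro t _
    rw [E_mk c hc]
    congr 1
    rw [map_add, map_mul, map_mul, map_mul, map_pow, map_pow, mk_rep, mk_rep, hW]

theorem E_red (p : OK) (hp : p ≠ 0) (k : ℕ) (y : OK ⧸ Ideal.span {p ^ (k + 1)}) :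
    E (p ^ (k + 1)) (pow_ne_zero _ hp) (Ideal.Quotient.mk _ p ^ k * y) =
      E p hp (red p _ (dvd_pow_self p (Nat.succ_ne_zero k)) y) := by
  obtain ⟨a, rfl⟩ := Ideal.Quotient.mk_surjective y
  rw [← map_pow, ← map_mul, E_pow, red_mk]

theorem P_pow (p : OK) (k m : ℕ) (h : k ≤ m) :
    (Ideal.Quotient.mk (Ideal.span {p ^ k}) p) ^ m = 0 := by
  rw [← map_pow, mk_zero_iff]
  exact pow_dvd_pow p h

theorem red_P (p c : OK) (h : p ∣ c) : red p c h (Ideal.Quotient.mk _ p) = 0 := by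
  rw [red_mk, mk_zero_iff]

theorem exists_v (p : OK) (k m : ℕ) (hm : 1 ≤ m) (y : OK ⧸ Ideal.span {p ^ k}) :
    ∃ v : (OK ⧸ Ideal.span {p ^ k})ˣ, v.val = 1 + Ideal.Quotient.mk _ p ^ m * y := by
  have : IsNilpotent (Ideal.Quotient.mk (Ideal.span {p ^ k}) p ^ m * y) := by
    refine ⟨k, ?_⟩
    rw [mul_pow, ← pow_mul, P_pow p k _ (Nat.le_mul_of_pos_left k hm), zero_mul]
  obtain ⟨v, hv⟩ := this.isUnit_one_add
  exact ⟨v, hv⟩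

theorem exists_lift (p c : OK) (h : p ∣ c) :
    ∃ s : (OK ⧸ Ideal.span {p}) → (OK ⧸ Ideal.span {c}), ∀ t, red p c h (s t) = t :=
  ⟨Function.surjInv (red_surj p c h), Function.surjInv_eq _⟩

theorem red_unit_ne (p c : OK) (hp : Prime p) (h : p ∣ c) (u : (OK ⧸ Ideal.span {c})ˣ) :
    red p c h u ≠ 0 := by
  have := isMax p hp
  let : Field (OK ⧸ Ideal.span {p}) := Ideal.Quotient.field _
  exact (Units.map (red p c h).toMonoidHom u).ne_zero

theorem vanish_a (p b : OK) (hp : Prime p) (hp3 : (3 : OK) ∣ p - 1) (m : ℕ) (k : ℕ)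
    [Fintype (OK ⧸ Ideal.span {p ^ (m + 2)})ˣ]
    (W : (OK ⧸ Ideal.span {p ^ (m + 2)})ˣ) (x : OK ⧸ Ideal.span {p ^ (m + 2)})
    (hx : red p _ (dvd_pow_self p (Nat.succ_ne_zero (m + 1))) x ≠ 0) :
    ∑ u : (OK ⧸ Ideal.span {p ^ (m + 2)})ˣ,
      chi p hp hp3 (red p _ (dvd_pow_self p (Nat.succ_ne_zero (m + 1))) u) ^ k *
      E (p ^ (m + 2)) (pow_ne_zero _ hp.ne_zero)
        (Ideal.Quotient.mk (Ideal.span {p ^ (m + 2)}) p * (W⁻¹ * u⁻¹ : (OK ⧸ Ideal.span {p ^ (m + 2)})ˣ).val) *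
      E (p ^ (m + 2)) (pow_ne_zero _ hp.ne_zero)
        (u.val * W.val ^ 2 * x ^ 3 + Ideal.Quotient.mk (Ideal.span {p ^ (m + 2)}) b * x) = 0 := by
  have hmax := isMax p hp
  have := finQ p hp.ne_zero
  let : Field (OK ⧸ Ideal.span {p}) := Ideal.Quotient.field _
  have := Fintype.ofFinite (OK ⧸ Ideal.span {p})
  set hd := dvd_pow_self p (Nat.succ_ne_zero (m + 1))
  set P := Ideal.Quotient.mk (Ideal.span {p ^ (m + 2)}) p with hP
  have hP0 : P ^ (m + 2) = 0 := P_pow p _ _ le_rfl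
  obtain ⟨s, hs⟩ := exists_lift p _ hd
  choose v hv using fun t => exists_v p (m + 2) (m + 1) (by omega) (s t)
  apply vanish _ v
  intro u
  have hred : ∀ t, red p _ hd (v t) = 1 := by
    intro t
    rw [hv, map_add, map_mul, map_pow, red_P, map_one]
    simp
  have hPv : ∀ t, P * (v t)⁻¹.val = P := by
    intro t
    have : P * (v t).val = P := by
      rw [hv]
      linear_combination (s t) * hP0
    rw [Units.mul_inv_eq_iff_eq_mul, this]
  have key : ∀ t, 
      chi p hp hp3 (red p _ hd ((u * v t : (OK ⧸ Ideal.span {p ^ (m + 2)})ˣ).val)) ^ k *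
      E (p ^ (m + 2)) (pow_ne_zero _ hp.ne_zero)
        (P * (W⁻¹ * (u * v t)⁻¹ : (OK ⧸ Ideal.span {p ^ (m + 2)})ˣ).val) *
      E (p ^ (m + 2)) (pow_ne_zero _ hp.ne_zero)
        ((u * v t : (OK ⧸ Ideal.span {p ^ (m + 2)})ˣ).val * W.val ^ 2 * x ^ 3
          + Ideal.Quotient.mk (Ideal.span {p ^ (m + 2)}) b * x) =
      chi p hp hp3 (red p _ hd u) ^ k *
      E (p ^ (m + 2)) (pow_ne_zero _ hp.ne_zero)
        (P * (W⁻¹ * u⁻¹ : (OK ⧸ Ideal.span {p ^ (m + 2)})ˣ).val) *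
      E (p ^ (m + 2)) (pow_ne_zero _ hp.ne_zero)
        (u.val * W.val ^ 2 * x ^ 3 + Ideal.Quotient.mk (Ideal.span {p ^ (m + 2)}) b * x) *
      E p hp.ne_zero (red p _ hd (u.val * W.val ^ 2 * x ^ 3) * t) := by
    intro t
    have e1 : P * (W⁻¹ * (u * v t)⁻¹ : (OK ⧸ Ideal.span {p ^ (m + 2)})ˣ).val =
        P * (W⁻¹ * u⁻¹ : (OK ⧸ Ideal.span {p ^ (m + 2)})ˣ).val := by
      rw [mul_inv_rev]
      push_cast
      linear_combination W⁻¹.val * u⁻¹.val * hPv t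
    have e2 : (u * v t : (OK ⧸ Ideal.span {p ^ (m + 2)})ˣ).val * W.val ^ 2 * x ^ 3
          + Ideal.Quotient.mk (Ideal.span {p ^ (m + 2)}) b * x =
        (u.val * W.val ^ 2 * x ^ 3 + Ideal.Quotient.mk (Ideal.span {p ^ (m + 2)}) b * x) +
          P ^ (m + 1) * ((u.val * W.val ^ 2 * x ^ 3) * s t) := by
      rw [Units.val_mul, hv]
      ring
    rw [e1, e2, AddChar.map_add_eq_mul, hP, E_red p hp.ne_zero, map_mul (red _ _ _) (_ * _ ^ 3), hs,
      Units.val_mul, map_mul (red _ _ _) u.val, hred, mul_one]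
    ring
  rw [Finset.sum_congr rfl fun t _ => key t, ← Finset.mul_sum,
    sum_psi (E p hp.ne_zero) (E_ne p hp), mul_zero]
  rw [map_mul, map_mul, map_pow, map_pow]
  exact mul_ne_zero (mul_ne_zero (red_unit_ne p _ hp hd u)
    (pow_ne_zero _ (red_unit_ne p _ hp hd W))) (pow_ne_zero _ hx)

theorem vanish_b (p b : OK) (hp : Prime p) (hp3 : (3 : OK) ∣ p - 1) (m : ℕ) (k : ℕ)
    [Fintype (OK ⧸ Ideal.span {p ^ (m + 3)})ˣ]
    (W : (OK ⧸ Ideal.span {p ^ (m + 3)})ˣ) (x : OK ⧸ Ideal.span {p ^ (m + 3)})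
    (hx : red p _ (dvd_pow_self p (Nat.succ_ne_zero (m + 2))) x = 0) :
    ∑ u : (OK ⧸ Ideal.span {p ^ (m + 3)})ˣ,
      chi p hp hp3 (red p _ (dvd_pow_self p (Nat.succ_ne_zero (m + 2))) u) ^ k *
      E (p ^ (m + 3)) (pow_ne_zero _ hp.ne_zero)
        (Ideal.Quotient.mk (Ideal.span {p ^ (m + 3)}) p * (W⁻¹ * u⁻¹ : (OK ⧸ Ideal.span {p ^ (m + 3)})ˣ).val) *
      E (p ^ (m + 3)) (pow_ne_zero _ hp.ne_zero)
        (u.val * W.val ^ 2 * x ^ 3 + Ideal.Quotient.mk (Ideal.span {p ^ (m + 3)}) b * x) = 0 := by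
  have hmax := isMax p hp
  have := finQ p hp.ne_zero
  let : Field (OK ⧸ Ideal.span {p}) := Ideal.Quotient.field _
  have := Fintype.ofFinite (OK ⧸ Ideal.span {p})
  set hd := dvd_pow_self p (Nat.succ_ne_zero (m + 2))
  obtain ⟨y, hy⟩ := red_zero p _ hd x hx
  set P := Ideal.Quotient.mk (Ideal.span {p ^ (m + 3)}) p with hP
  have hP0 : P ^ (m + 3) = 0 := P_pow p _ _ le_rfl
  obtain ⟨s, hs⟩ := exists_lift p _ hd
  choose v hv using fun t => exists_v p (m + 3) (m + 1) (by omega) (s t)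
  apply vanish _ v
  intro u
  have hred : ∀ t, red p _ hd (v t) = 1 := by
    intro t
    rw [hv, map_add, map_mul, map_pow, red_P, map_one]
    simp
  have hPv : ∀ t, P * (v t)⁻¹.val = P * (1 - P ^ (m + 1) * s t) := by
    intro t
    rw [Units.mul_inv_eq_iff_eq_mul, hv]
    linear_combination P ^ m * (s t) ^ 2 * hP0
  have key : ∀ t, 
      chi p hp hp3 (red p _ hd ((u * v t : (OK ⧸ Ideal.span {p ^ (m + 3)})ˣ).val)) ^ k *
      E (p ^ (m + 3)) (pow_ne_zero _ hp.ne_zero)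
        (P * (W⁻¹ * (u * v t)⁻¹ : (OK ⧸ Ideal.span {p ^ (m + 3)})ˣ).val) *
      E (p ^ (m + 3)) (pow_ne_zero _ hp.ne_zero)
        ((u * v t : (OK ⧸ Ideal.span {p ^ (m + 3)})ˣ).val * W.val ^ 2 * x ^ 3
          + Ideal.Quotient.mk (Ideal.span {p ^ (m + 3)}) b * x) =
      chi p hp hp3 (red p _ hd u) ^ k *
      E (p ^ (m + 3)) (pow_ne_zero _ hp.ne_zero)
        (P * (W⁻¹ * u⁻¹ : (OK ⧸ Ideal.span {p ^ (m + 3)})ˣ).val) *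
      E (p ^ (m + 3)) (pow_ne_zero _ hp.ne_zero)
        (u.val * W.val ^ 2 * x ^ 3 + Ideal.Quotient.mk (Ideal.span {p ^ (m + 3)}) b * x) *
      E p hp.ne_zero (red p _ hd (-(W⁻¹ * u⁻¹ : (OK ⧸ Ideal.span {p ^ (m + 3)})ˣ).val) * t) := by
    intro t
    have e1 : P * (W⁻¹ * (u * v t)⁻¹ : (OK ⧸ Ideal.span {p ^ (m + 3)})ˣ).val =
        P * (W⁻¹ * u⁻¹ : (OK ⧸ Ideal.span {p ^ (m + 3)})ˣ).val +
        P ^ (m + 2) * (-(W⁻¹ * u⁻¹ : (OK ⧸ Ideal.span {p ^ (m + 3)})ˣ).val * s t) := by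
      rw [mul_inv_rev]
      push_cast
      linear_combination W⁻¹.val * u⁻¹.val * hPv t
    have e2 : (u * v t : (OK ⧸ Ideal.span {p ^ (m + 3)})ˣ).val * W.val ^ 2 * x ^ 3
          + Ideal.Quotient.mk (Ideal.span {p ^ (m + 3)}) b * x =
        (u.val * W.val ^ 2 * x ^ 3 + Ideal.Quotient.mk (Ideal.span {p ^ (m + 3)}) b * x) := by
      rw [Units.val_mul, hv, hy]
      linear_combination (u.val * W.val ^ 2 * y ^ 3 * P * s t) * hP0
    rw [e1, e2, AddChar.map_add_eq_mul, hP, E_red p hp.ne_zero, map_mul (red _ _ _) (-_), hs,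
      Units.val_mul u, map_mul (red _ _ _) u.val, hred, mul_one]
    ring
  rw [Finset.sum_congr rfl fun t _ => key t, ← Finset.mul_sum,
    sum_psi (E p hp.ne_zero) (E_ne p hp), mul_zero]
  rw [map_neg]
  exact neg_ne_zero.2 (red_unit_ne p _ hp hd _)

theorem exists_W (p w : OK) (h : IsCoprime w p) (k : ℕ) :
    ∃ W : (OK ⧸ Ideal.span {p ^ k})ˣ, W.val = Ideal.Quotient.mk _ w := by
  obtain ⟨a, b, hab⟩ := h.pow_right (n := k)
  have : IsUnit (Ideal.Quotient.mk (Ideal.span {p ^ k}) w) := by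
    apply IsUnit.of_mul_eq_one (Ideal.Quotient.mk _ a)
    rw [← map_mul, ← map_one (Ideal.Quotient.mk _), mk_eq_iff]
    exact ⟨-b, by linear_combination hab⟩
  obtain ⟨W, hW⟩ := this
  exact ⟨W, hW⟩

theorem gauss_eq (p : OK) (hp : Prime p) (hp3 : (3 : OK) ∣ p - 1)
    [Fintype (OK ⧸ Ideal.span {p})ˣ] :
    gaussSum 1 p = ∑ v : (OK ⧸ Ideal.span {p})ˣ, chi p hp hp3 v * E p hp.ne_zero v := by
  unfold gaussSum
  rw [finsum_eq_sum_of_fintype]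
  apply Finset.sum_congr rfl
  intro v _
  rw [cubicChar_eq p hp, chi_mk p hp hp3, mk_rep, E_mk p hp.ne_zero, one_mul, mk_rep]

theorem S8_three (p w B : OK) (hp : Prime p) (hp3 : (3 : OK) ∣ p - 1)
    (hw : IsCoprime w p) (j m : ℕ) : S8 p w B j (m + 3) = 0 := by
  have hc : p ^ (m + 3) ≠ 0 := pow_ne_zero _ hp.ne_zero
  have := finQ _ hc
  have := Fintype.ofFinite (OK ⧸ Ideal.span {p ^ (m + 3)})
  have := Fintype.ofFinite (OK ⧸ Ideal.span {p ^ (m + 3)})ˣ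
  obtain ⟨W, hW⟩ := exists_W p w hw (m + 3)
  unfold S8
  rw [S_eq p w B _ hp hp3 hc (dvd_pow_self p (Nat.succ_ne_zero (m + 2))) j (m + 3) W hW]
  simp_rw [Finset.mul_sum]
  rw [Finset.sum_comm]
  apply Finset.sum_eq_zero
  intro x _
  by_cases hx : red p _ (dvd_pow_self p (Nat.succ_ne_zero (m + 2))) x = 0
  · exact vanish_b p _ hp hp3 m (m + 3) W x hx
  · exact vanish_a p _ hp hp3 (m + 1) (m + 3) W x hx

theorem S8_one (p w B : OK) (hp : Prime p) (hp3 : (3 : OK) ∣ p - 1)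
    (hw : IsCoprime w p) (j : ℕ) (hj : 1 ≤ j) :
    S8 p w B j 1 = (totient p : ℂ) * ((cubicCharP p w : OK) : ℂ) * gaussSum 1 p := by
  have := finQ _ hp.ne_zero
  have hmax := isMax p hp
  let : Field (OK ⧸ Ideal.span {p}) := Ideal.Quotient.field _
  have := Fintype.ofFinite (OK ⧸ Ideal.span {p})
  have := Fintype.ofFinite (OK ⧸ Ideal.span {p})ˣ
  obtain ⟨W, hW⟩ := exists_W p w hw 1
  unfold S8
  revert W
  rw [pow_one p]
  intro W hW
  rw [S_eq p w B _ hp hp3 hp.ne_zero dvd_rfl j 1 W hW]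
  have hr : ∀ y, red p p dvd_rfl y = y := by
    intro y
    obtain ⟨a, rfl⟩ := Ideal.Quotient.mk_surjective y
    rfl
  have hP : Ideal.Quotient.mk (Ideal.span {p}) p = 0 := by rw [mk_zero_iff]
  have hB : Ideal.Quotient.mk (Ideal.span {p}) (p ^ j * B) = 0 := by
    rw [mk_zero_iff]
    exact (dvd_pow_self p (by omega)).mul_right B
  simp only [hr, hP, hB, zero_mul, add_zero, AddChar.map_zero_eq_one, mul_one, pow_one]
  rw [gauss_eq p hp hp3, chi_mk p hp hp3, ← hW]
  exact sum_k1 (chi p hp hp3) (E p hp.ne_zero) (chi_cube p hp hp3) (chi_ne p hp hp3) W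

theorem S8_two (p w B : OK) (hp : Prime p) (hp3 : (3 : OK) ∣ p - 1)
    (hw : IsCoprime w p) (j : ℕ) (hj : 1 ≤ j) :
    S8 p w B j 2 = (Nm p : ℂ) ^ 2 * ((cubicCharP p w : OK) : ℂ) * gaussSum 1 p := by
  have hc : p ^ 2 ≠ 0 := pow_ne_zero _ hp.ne_zero
  have := finQ _ hp.ne_zero
  have := finQ _ hc
  have := Fintype.ofFinite (OK ⧸ Ideal.span {p})
  have := Fintype.ofFinite (OK ⧸ Ideal.span {p})ˣ
  have := Fintype.ofFinite (OK ⧸ Ideal.span {p ^ 2})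
  have := Fintype.ofFinite (OK ⧸ Ideal.span {p ^ 2})ˣ
  obtain ⟨W, hW⟩ := exists_W p w hw 2
  have hd : p ∣ p ^ 2 := dvd_pow_self p (Nat.succ_ne_zero 1)
  unfold S8
  rw [S_eq p w B _ hp hp3 hc hd j 2 W hW]
  set P := Ideal.Quotient.mk (Ideal.span {p ^ 2}) p with hP
  have hP0 : P ^ 2 = 0 := P_pow p _ _ le_rfl
  obtain ⟨i, rfl⟩ : ∃ i, j = i + 1 := ⟨j - 1, by omega⟩
  obtain ⟨s, hs⟩ := exists_lift p _ hd
  -- multiplication by `P` is injective modulo `p`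
  have hinj : ∀ a b, P * s a = P * s b → a = b := by
    intro a b hab
    rw [← hs a, ← hs b]
    obtain ⟨a', ha'⟩ := Ideal.Quotient.mk_surjective (s a)
    obtain ⟨b', hb'⟩ := Ideal.Quotient.mk_surjective (s b)
    rw [← ha', ← hb', hP, ← map_mul, ← map_mul, mk_eq_iff, ← mul_sub, pow_two] at hab
    rw [← ha', ← hb', red_mk, red_mk, mk_eq_iff]
    exact (mul_dvd_mul_iff_left hp.ne_zero).1 hab
  have hsur : ∀ x, red p _ hd x = 0 → ∃ t, P * s t = x := by
    intro x hx
    obtain ⟨y, rfl⟩ := red_zero p _ hd x hx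
    refine ⟨red p _ hd y, ?_⟩
    obtain ⟨z, hz⟩ := red_zero p _ hd (s (red p _ hd y) - y) (by rw [map_sub, hs, sub_self])
    linear_combination P * hz + z * hP0
  have hcard1 : (Finset.univ.filter (fun x => red p _ hd x = 0)).card = Nm p := by
    unfold Nm
    rw [Nat.card_eq_fintype_card, ← Finset.card_univ]
    symm
    apply Finset.card_bij (fun t _ => P * s t)
    · intro t _
      simp [hP, red_P]
    · intro a _ b _ hab
      exact hinj a b hab
    · intro x hx
      obtain ⟨t, ht⟩ := hsur x (Finset.mem_filter.1 hx).2
      exact ⟨t, Finset.mem_univ _, ht⟩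
  choose v hv using fun t => exists_v p 2 1 le_rfl (s t)
  have hcard2 : (Finset.univ.filter
      (fun u => Units.map (red p _ hd).toMonoidHom u = 1)).card = Nm p := by
    unfold Nm
    rw [Nat.card_eq_fintype_card, ← Finset.card_univ]
    symm
    apply Finset.card_bij (fun t _ => v t)
    · intro t _
      rw [Finset.mem_filter]
      refine ⟨Finset.mem_univ _, ?_⟩
      apply Units.ext
      change red p _ hd (v t) = 1
      rw [hv, map_add, map_mul, map_pow, red_P, map_one]
      simp
    · intro a _ b _ hab
      apply hinj
      have := congrArg Units.val hab
      rw [hv, hv, pow_one] at this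
      exact add_left_cancel this
    · intro x hx
      have hx1 : red p _ hd x.val = 1 := congrArg Units.val (Finset.mem_filter.1 hx).2
      obtain ⟨t, ht⟩ := hsur (x.val - 1) (by rw [map_sub, hx1, map_one, sub_self])
      refine ⟨t, Finset.mem_univ _, ?_⟩
      apply Units.ext
      rw [hv]
      linear_combination ht
  simp_rw [Finset.mul_sum]
  rw [Finset.sum_comm]
  have hin : ∀ x : OK ⧸ Ideal.span {p ^ 2}, ∑ u : (OK ⧸ Ideal.span {p ^ 2})ˣ,
      chi p hp hp3 (red p _ hd u) ^ 2 *
      E (p ^ 2) hc (P * (W⁻¹ * u⁻¹ : (OK ⧸ Ideal.span {p ^ 2})ˣ).val) *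
      E (p ^ 2) hc (u.val * W.val ^ 2 * x ^ 3 + Ideal.Quotient.mk (Ideal.span {p ^ 2}) (p ^ (i + 1) * B) * x) =
      if red p _ hd x = 0 then ∑ u : (OK ⧸ Ideal.span {p ^ 2})ˣ,
      chi p hp hp3 (red p _ hd u) ^ 2 *
      E (p ^ 2) hc (P * (W⁻¹ * u⁻¹ : (OK ⧸ Ideal.span {p ^ 2})ˣ).val) else 0 := by
    intro x
    split_ifs with hx
    · apply Finset.sum_congr rfl
      intro u _
      obtain ⟨y, rfl⟩ := red_zero p _ hd x hx
      have : (u.val * W.val ^ 2 * (P * y) ^ 3 + Ideal.Quotient.mk (Ideal.span {p ^ 2}) (p ^ (i + 1) * B) * (P * y)) = 0 := by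
        rw [map_mul, map_pow, ← hP]
        linear_combination (u.val * W.val ^ 2 * P * y ^ 3 + P ^ i * Ideal.Quotient.mk (Ideal.span {p ^ 2}) B * y) * hP0
      rw [this, AddChar.map_zero_eq_one, mul_one]
    · exact vanish_a p _ hp hp3 0 2 W x hx
  simp_rw [hin]
  rw [← Finset.sum_filter, Finset.sum_const, hcard1, nsmul_eq_mul]
  set W1 := Units.map (red p _ hd).toMonoidHom W with hW1
  have hE : ∀ u : (OK ⧸ Ideal.span {p ^ 2})ˣ,
      chi p hp hp3 (red p _ hd u) ^ 2 *
        E (p ^ 2) hc (P * (W⁻¹ * u⁻¹ : (OK ⧸ Ideal.span {p ^ 2})ˣ).val) =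
      (fun v : (OK ⧸ Ideal.span {p})ˣ => chi p hp hp3 v.val ^ 2 *
        E p hp.ne_zero (W1⁻¹ * v⁻¹ : (OK ⧸ Ideal.span {p})ˣ).val)
        (Units.map (red p _ hd).toMonoidHom u) := by
    intro u
    have h := E_red p hp.ne_zero 1 (W⁻¹ * u⁻¹ : (OK ⧸ Ideal.span {p ^ 2})ˣ).val
    rw [pow_one] at h
    simp only []
    rw [hW1, ← map_inv, ← map_inv, ← map_mul]
    exact congrArg _ h
  rw [Finset.sum_congr rfl fun u _ => hE u, sum_fib _ ?_
    (fun v : (OK ⧸ Ideal.span {p})ˣ => chi p hp hp3 v.val ^ 2 *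
        E p hp.ne_zero (W1⁻¹ * v⁻¹ : (OK ⧸ Ideal.span {p})ˣ).val), hcard2,
    sum_k2 _ _ (chi_cube p hp hp3), gauss_eq p hp hp3]
  · have : (W1 : OK ⧸ Ideal.span {p}) = Ideal.Quotient.mk _ w := by
      change red p _ hd W.val = _
      rw [hW, red_mk]
    rw [this, ← chi_mk]
    ring
  · intro y
    obtain ⟨a, ha⟩ := red_surj p _ hd y
    obtain ⟨b, hb⟩ := red_surj p _ hd (y⁻¹ : (OK ⧸ Ideal.span {p})ˣ)
    obtain ⟨z, hz⟩ := red_zero p _ hd (a * b - 1) (by rw [map_sub, map_mul, ha, hb]; simp)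
    have hu : IsUnit a := by
      apply IsUnit.of_mul_eq_one (b * (1 - P * z))
      linear_combination (1 - P * z) * hz - z ^ 2 * hP0
    obtain ⟨u, hu⟩ := hu
    refine ⟨u, Units.ext ?_⟩
    change red p _ hd u.val = _
    rw [hu, ha]

/- Statement 8 -/
theorem stmt8 (p w B : OK) (hp : Prime p) (hp3 : (3 : OK) ∣ p - 1)
    (hco : IsCoprime (w * B) p) (j : ℕ) (hj : 1 ≤ j) :
    S8 p w B j 1 = (totient p : ℂ) * ((cubicCharP p w : OK) : ℂ) * gaussSum 1 p ∧
    S8 p w B j 2 = (Nm p : ℂ) ^ 2 * ((cubicCharP p w : OK) : ℂ) * gaussSum 1 p ∧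
    ∀ k : ℕ, 3 ≤ k → S8 p w B j k = 0 := by
  have hw : IsCoprime w p := hco.of_mul_left_left
  refine ⟨S8_one p w B hp hp3 hw j hj, S8_two p w B hp hp3 hw j hj, ?_⟩
  intro k hk
  obtain ⟨m, rfl⟩ := Nat.exists_eq_add_of_le' hk
  exact S8_three p w B hp hp3 hw j m

end CubicSeries
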